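/- arXiv:1507.06038 — 2 statements merged into one kernel-verified Lean document; each statement's English description precedes it below -/
import Mathlib

section
/- Let η(x) = −x log₂ x for x > 0, with η(0) = 0. There exists c₀ ∈ (0,1) such that for all c ∈ (0, c₀] and all x ∈ [0,1]: if η(x) ≤ η(c), then either x ≤ c or x ≥ 1 − 2·η(c). Equivalently, for all x in the interval [c, 1 − 2η(c)] one has η(x) ≥ η(c). -/
/-- The function `η(x) = -x log₂ x` (with `η(0) = 0`, which holds since `Real.logb 2 0 = 0`). -/
noncomputable def binEta (x : ℝ) : ℝ := -x * Real.logb 2 x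

lemma binEta_eq_negMulLog_div (x : ℝ) : binEta x = Real.negMulLog x / Real.log 2 := by
  simp only [binEta, Real.negMulLog, Real.logb]
  ring

lemma strictConcaveOn_binEta : StrictConcaveOn ℝ (Set.Ici (0 : ℝ)) binEta := by
  refine ⟨convex_Ici 0, fun x hx y hy hxy a b ha hb hab => ?_⟩
  have h := Real.strictConcaveOn_negMulLog.2 hx hy hxy ha hb hab
  have h2 : 0 < Real.log 2 := Real.log_pos one_lt_two
  simp only [binEta_eq_negMulLog_div, smul_eq_mul] at h ⊢
  calc
    _ = (a * Real.negMulLog x + b * Real.negMulLog y) / Real.log 2 := by ring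
    _ < _ := by gcongr

lemma le_binEta_one_sub_two_mul {h : ℝ} (h0 : 0 ≤ h) (h1 : h ≤ 1 / 4) :
    h ≤ binEta (1 - 2 * h) := by
  have hlog : Real.log (1 - 2 * h) ≤ -(2 * h) := by
    linarith [Real.log_le_sub_one_of_pos (show 0 < 1 - 2 * h by linarith)]
  have h2 : 0 < Real.log 2 := Real.log_pos one_lt_two
  have h2' : Real.log 2 ≤ 1 := by linarith [Real.log_two_lt_d9]
  rw [binEta_eq_negMulLog_div, le_div_iff₀ h2, Real.negMulLog]
  nlinarith

lemma exists_binEta_le_quarter :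
    ∃ c₀ ∈ Set.Ioo (0 : ℝ) 1, ∀ c ∈ Set.Ioc (0 : ℝ) c₀, binEta c ≤ 1 / 4 := by
  have hc : Continuous binEta := by
    rw [funext binEta_eq_negMulLog_div]
    fun_prop
  have h0 : binEta 0 < 1 / 4 := by norm_num [binEta]
  obtain ⟨ε, hε, h⟩ := Metric.eventually_nhds_iff.1
    (hc.continuousAt.eventually_lt continuousAt_const h0)
  refine ⟨min (ε / 2) (1 / 2), ⟨by positivity, min_lt_of_right_lt (by norm_num)⟩, fun c hc => (h ?_).le⟩
  have := hc.2.trans (min_le_left _ _)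
  rw [Real.dist_eq, sub_zero, abs_of_pos hc.1]
  linarith

/-- There is a threshold `c₀ ∈ (0,1)` such that for all `c ∈ (0, c₀]` and `x ∈ [0,1]`:
if `η(x) ≤ η(c)` then `x ≤ c` or `x ≥ 1 - 2 η(c)`; equivalently, `η(x) ≥ η(c)` for all
`x ∈ [c, 1 - 2 η(c)]`. -/
theorem eta_roots_bound :
    ∃ c₀ ∈ Set.Ioo (0 : ℝ) 1, ∀ c ∈ Set.Ioc (0 : ℝ) c₀,
      (∀ x ∈ Set.Icc (0 : ℝ) 1, binEta x ≤ binEta c → x ≤ c ∨ 1 - 2 * binEta c ≤ x) ∧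
      (∀ x ∈ Set.Icc c (1 - 2 * binEta c), binEta c ≤ binEta x) := by
  obtain ⟨c₀, hc₀, hquarter⟩ := exists_binEta_le_quarter
  refine ⟨c₀, hc₀, fun c hc => ?_⟩
  have hnonneg : 0 ≤ binEta c := by
    rw [binEta_eq_negMulLog_div]
    exact div_nonneg (Real.negMulLog_nonneg hc.1.le (hc.2.trans hc₀.2.le))
      (Real.log_pos one_lt_two).le
  have hle := hquarter c hc
  have hend := le_binEta_one_sub_two_mul hnonneg hle
  have hd : 1 - 2 * binEta c ∈ Set.Ici (0 : ℝ) := by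
    rw [Set.mem_Ici]
    linarith
  constructor
  · intro x _ hxle
    by_contra! hx
    have hseg : x ∈ openSegment ℝ c (1 - 2 * binEta c) := by
      rw [openSegment_eq_Ioo (hx.1.trans hx.2)]
      exact hx
    have hlt := strictConcaveOn_binEta.lt_on_openSegment hc.1.le hd (hx.1.trans hx.2).ne hseg
    rw [min_eq_left hend] at hlt
    exact hlt.not_ge hxle
  · intro x hx
    have hmin := strictConcaveOn_binEta.concaveOn.min_le_of_mem_Icc hc.1.le hd hx
    rwa [min_eq_left hend] at hmin
end

section
/- Let μ be the Haar probability measure on the group U(d) of d×d complex unitary matrices and let ψ ∈ ℂ^d be a unit vector with ρ = ψψ†. Then for all d×d complex matrices A and B, ∫ Tr(A·UρU†) · Tr(B·UρU†) dμ(U) = (2/(d(d+1))) · Tr( (A ⊗ B) · P_sym ), where ⊗ is the Kronecker product and P_sym = (1/2)(I + S) is the projector onto the symmetric subspace of ℂ^d ⊗ ℂ^d, with S the swap matrix having entries S_{(i,j),(k,l)} = δ_{i,l} δ_{j,k}. -/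
open MeasureTheory
open Kronecker

noncomputable instance matrixMeasurableSpace (d : ℕ) :
    MeasurableSpace (Matrix (Fin d) (Fin d) ℂ) := borel _

/-- The swap matrix `S` on `ℂ^d ⊗ ℂ^d`, with entries `S_{(i,j),(k,l)} = δ_{i,l} δ_{j,k}`. -/
def swapMatrix (d : ℕ) : Matrix (Fin d × Fin d) (Fin d × Fin d) ℂ :=
  fun p q => if p.1 = q.2 ∧ p.2 = q.1 then 1 else 0

/-- The projector `P_sym = (I + S)/2` onto the symmetric subspace of `ℂ^d ⊗ ℂ^d`. -/
noncomputable def symProj (d : ℕ) : Matrix (Fin d × Fin d) (Fin d × Fin d) ℂ :=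
  (1 / 2 : ℂ) • ((1 : Matrix (Fin d × Fin d) (Fin d × Fin d) ℂ) + swapMatrix d)

section HaarMoments

variable {d : ℕ}

instance matrixBorelSpace (d : ℕ) : BorelSpace (Matrix (Fin d) (Fin d) ℂ) := ⟨rfl⟩

/-- The fourth-order monomial `x_i x_j conj(x_k) conj(x_l)`. -/
def quarticMonomial (i j k l : Fin d) (x : Fin d → ℂ) : ℂ :=
  x i * x j * (star (x k) * star (x l))

/-- The fourth-order moments of the Haar-random vector `Uψ`. -/
noncomputable def quarticMoment (μ : Measure (Matrix.unitaryGroup (Fin d) ℂ)) (ψ : Fin d → ℂ)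
    (i j k l : Fin d) : ℂ :=
  ∫ U : Matrix.unitaryGroup (Fin d) ℂ,
    quarticMonomial i j k l ((U : Matrix (Fin d) (Fin d) ℂ).mulVec ψ) ∂μ

theorem integral_quarticMonomial (μ : Measure (Matrix.unitaryGroup (Fin d) ℂ)) (ψ : Fin d → ℂ)
    (i j k l : Fin d) :
    ∫ U : Matrix.unitaryGroup (Fin d) ℂ,
      quarticMonomial i j k l ((U : Matrix (Fin d) (Fin d) ℂ).mulVec ψ) ∂μ =
      quarticMoment μ ψ i j k l := rfl

theorem sum_mul_star_unitary_mulVec {ψ : Fin d → ℂ} (hψ : ∑ i, ‖ψ i‖ ^ 2 = 1)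
    (U : Matrix.unitaryGroup (Fin d) ℂ) :
    ∑ i, (U : Matrix (Fin d) (Fin d) ℂ).mulVec ψ i *
      star ((U : Matrix (Fin d) (Fin d) ℂ).mulVec ψ i) = 1 := by
  have h1 : ∑ i, ψ i * star (ψ i) = 1 := by
    have : ∀ i, ψ i * star (ψ i) = ((‖ψ i‖ ^ 2 : ℝ) : ℂ) := fun i => by
      push_cast
      exact Complex.mul_conj' (ψ i)
    simp_rw [this]
    rw [← Complex.ofReal_sum, hψ, Complex.ofReal_one]
  have hU : star (U : Matrix (Fin d) (Fin d) ℂ) * U = 1 := Matrix.mem_unitaryGroup_iff'.1 U.2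
  change (U : Matrix (Fin d) (Fin d) ℂ).mulVec ψ ⬝ᵥ
    star ((U : Matrix (Fin d) (Fin d) ℂ).mulVec ψ) = 1
  rw [dotProduct_comm, Matrix.star_mulVec, ← Matrix.dotProduct_mulVec, Matrix.mulVec_mulVec,
    ← Matrix.star_eq_conjTranspose, hU, Matrix.one_mulVec, dotProduct_comm]
  exact h1

theorem norm_unitary_mulVec_le_one {ψ : Fin d → ℂ} (hψ : ∑ i, ‖ψ i‖ ^ 2 = 1)
    (U : Matrix.unitaryGroup (Fin d) ℂ) (i : Fin d) :
    ‖(U : Matrix (Fin d) (Fin d) ℂ).mulVec ψ i‖ ≤ 1 := by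
  have h := sum_mul_star_unitary_mulVec hψ U
  have h2 : ∑ i, ‖(U : Matrix (Fin d) (Fin d) ℂ).mulVec ψ i‖ ^ 2 = 1 := by
    have h3 : ∀ z : ℂ, z * star z = ((‖z‖ ^ 2 : ℝ) : ℂ) := fun z => by
      push_cast
      exact Complex.mul_conj' z
    simp_rw [h3] at h
    exact_mod_cast h
  have h4 := Finset.single_le_sum (f := fun i => ‖(U : Matrix (Fin d) (Fin d) ℂ).mulVec ψ i‖ ^ 2)
    (fun _ _ => sq_nonneg _) (Finset.mem_univ i)
  rw [h2] at h4
  exact (sq_le_one_iff₀ (norm_nonneg _)).1 h4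

theorem integrable_quarticMonomial (μ : Measure (Matrix.unitaryGroup (Fin d) ℂ))
    [IsProbabilityMeasure μ] {ψ : Fin d → ℂ} (hψ : ∑ i, ‖ψ i‖ ^ 2 = 1) (i j k l : Fin d) :
    Integrable (fun U : Matrix.unitaryGroup (Fin d) ℂ =>
      quarticMonomial i j k l ((U : Matrix (Fin d) (Fin d) ℂ).mulVec ψ)) μ := by
  have hc : Continuous (fun U : Matrix.unitaryGroup (Fin d) ℂ =>
      (U : Matrix (Fin d) (Fin d) ℂ).mulVec ψ) :=
    continuous_subtype_val.matrix_mulVec continuous_const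
  refine Integrable.of_bound (C := 1) ?_ (Filter.Eventually.of_forall fun U => ?_)
  · refine Continuous.aestronglyMeasurable ?_
    unfold quarticMonomial
    fun_prop
  · have h := norm_unitary_mulVec_le_one hψ U
    simp only [quarticMonomial, norm_mul, norm_star]
    exact mul_le_one₀ (mul_le_one₀ (h i) (norm_nonneg _) (h j)) (by positivity)
      (mul_le_one₀ (h k) (norm_nonneg _) (h l))

/-- Left invariance of the moments under a fixed unitary. -/
theorem quarticMoment_eq_integral_mulVec (μ : Measure (Matrix.unitaryGroup (Fin d) ℂ))
    [μ.IsMulLeftInvariant] (ψ : Fin d → ℂ) {V : Matrix (Fin d) (Fin d) ℂ}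
    (hV : V ∈ Matrix.unitaryGroup (Fin d) ℂ) (i j k l : Fin d) :
    quarticMoment μ ψ i j k l = ∫ U : Matrix.unitaryGroup (Fin d) ℂ,
      quarticMonomial i j k l (V.mulVec ((U : Matrix (Fin d) (Fin d) ℂ).mulVec ψ)) ∂μ := by
  rw [quarticMoment, ← integral_mul_left_eq_self _ (⟨V, hV⟩ : Matrix.unitaryGroup (Fin d) ℂ)]
  simp only [Submonoid.coe_mul, Matrix.mulVec_mulVec]

/-- The phase vector equal to `Complex.I` at `a` and `1` elsewhere. -/
noncomputable def phaseAt (a : Fin d) : Fin d → ℂ := fun i => if i = a then Complex.I else 1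

theorem diagonal_phaseAt_mem_unitaryGroup (a : Fin d) :
    Matrix.diagonal (phaseAt a) ∈ Matrix.unitaryGroup (Fin d) ℂ := by
  rw [Matrix.mem_unitaryGroup_iff, Matrix.star_eq_conjTranspose, Matrix.diagonal_conjTranspose,
    Matrix.diagonal_mul_diagonal, ← Matrix.diagonal_one]
  congr 1
  ext i
  by_cases h : i = a <;> simp [phaseAt, h]

theorem quarticMoment_eq_phase_mul (μ : Measure (Matrix.unitaryGroup (Fin d) ℂ))
    [μ.IsMulLeftInvariant] (ψ : Fin d → ℂ) (a i j k l : Fin d) :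
    quarticMoment μ ψ i j k l =
      quarticMonomial i j k l (phaseAt a) * quarticMoment μ ψ i j k l := by
  conv_lhs => rw [quarticMoment_eq_integral_mulVec μ ψ (diagonal_phaseAt_mem_unitaryGroup a)]
  rw [quarticMoment, ← integral_const_mul]
  congr 1
  ext U
  simp only [quarticMonomial, Matrix.mulVec_diagonal, star_mul']
  ring

theorem quarticMoment_eq_zero (μ : Measure (Matrix.unitaryGroup (Fin d) ℂ))
    [μ.IsMulLeftInvariant] (ψ : Fin d → ℂ) {i j k l : Fin d}
    (h₁ : ¬(i = k ∧ j = l)) (h₂ : ¬(i = l ∧ j = k)) : quarticMoment μ ψ i j k l = 0 := by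
  have key : ∀ a, quarticMonomial i j k l (phaseAt a) ≠ 1 → quarticMoment μ ψ i j k l = 0 := by
    intro a ha
    by_contra h0
    exact ha (mul_right_cancel₀ h0 (by rw [one_mul, ← quarticMoment_eq_phase_mul]))
  have hI : Complex.I ≠ 1 := fun h => by simpa using congrArg Complex.re h
  have hI' : -Complex.I ≠ 1 := fun h => by simpa using congrArg Complex.re h
  have hm : (-1 : ℂ) ≠ 1 := by norm_num
  by_cases hi : i = k ∨ i = l
  · by_cases hj : j = k ∨ j = l
    · rcases hi with rfl | rfl
      · have hjl : j ≠ l := fun h => h₁ ⟨rfl, h⟩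
        obtain rfl : j = i := by tauto
        exact key l (by simp [quarticMonomial, phaseAt, hjl, hI'])
      · have hjk : j ≠ k := fun h => h₂ ⟨rfl, h⟩
        obtain rfl : j = i := by tauto
        exact key k (by simp [quarticMonomial, phaseAt, hjk, hI'])
    · push Not at hj
      refine key j ?_
      by_cases hij : i = j <;> simp [quarticMonomial, phaseAt, hj.1.symm, hj.2.symm, hij, hI, hm]
  · push Not at hi
    refine key i ?_
    by_cases hij : j = i <;> simp [quarticMonomial, phaseAt, hi.1.symm, hi.2.symm, hij, hI, hm]

/-- The unitary rotating the plane of coordinates `p` and `q`, given on that plane by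
`½ [[1 + i, i - 1], [i - 1, 1 + i]]`. -/
noncomputable def planeRotation (p q : Fin d) : Matrix (Fin d) (Fin d) ℂ :=
  1 + ((Complex.I - 1) / 2) •
    Matrix.vecMulVec (Pi.single p 1 + Pi.single q 1) (Pi.single p 1 + Pi.single q 1)

theorem planeRotation_mem_unitaryGroup {p q : Fin d} (hpq : p ≠ q) :
    planeRotation p q ∈ Matrix.unitaryGroup (Fin d) ℂ := by
  set w : Fin d → ℂ := Pi.single p 1 + Pi.single q 1 with hw
  have hs : star w = w := by
    simp [hw]
  have hww : w ⬝ᵥ w = 2 := by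
    simp [hw, hpq, hpq.symm]
    norm_num
  have hW : Matrix.vecMulVec w w * Matrix.vecMulVec w w = (2 : ℂ) • Matrix.vecMulVec w w := by
    rw [Matrix.vecMulVec_mul_vecMulVec, hww]
    ext i j
    simp [Matrix.vecMulVec_apply]
    ring
  have hWs : (Matrix.vecMulVec w w).conjTranspose = Matrix.vecMulVec w w := by
    rw [Matrix.conjTranspose_vecMulVec, hs]
  rw [Matrix.mem_unitaryGroup_iff, Matrix.star_eq_conjTranspose, planeRotation, ← hw,
    Matrix.conjTranspose_add, Matrix.conjTranspose_smul, hWs, Matrix.conjTranspose_one]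
  simp only [add_mul, mul_add, one_mul, mul_one, Matrix.smul_mul, Matrix.mul_smul, hW, smul_smul]
  rw [add_assoc, ← add_smul, ← add_smul]
  have : (Complex.I - 1) / 2 + (star ((Complex.I - 1) / 2) +
      star ((Complex.I - 1) / 2) * ((Complex.I - 1) / 2 * 2)) = 0 := by
    simp
    linear_combination (-1 / 2 : ℂ) * Complex.I_sq
  rw [this, zero_smul, add_zero]

theorem planeRotation_mulVec_left {p q : Fin d} (hpq : p ≠ q) (x : Fin d → ℂ) :
    (planeRotation p q).mulVec x p =
      (1 + Complex.I) / 2 * x p + (Complex.I - 1) / 2 * x q := by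
  simp [planeRotation, Matrix.add_mulVec, Matrix.smul_mulVec, Matrix.vecMulVec_mulVec, hpq,
    add_dotProduct]
  ring

theorem quarticMonomial_planeRotation {p q : Fin d} (hpq : p ≠ q) (x : Fin d → ℂ) :
    quarticMonomial p p p p ((planeRotation p q).mulVec x) =
      1 / 4 * quarticMonomial p p p p x + 1 / 4 * quarticMonomial q q q q x
      + quarticMonomial p q p q x
      + (-1 / 4) * quarticMonomial p p q q x + (-1 / 4) * quarticMonomial q q p p x
      + (-Complex.I / 2) * quarticMonomial p p p q x + (Complex.I / 2) * quarticMonomial q q p q x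
      + (Complex.I / 2) * quarticMonomial p q p p x
      + (-Complex.I / 2) * quarticMonomial p q q q x := by
  have h1 : ∀ a b : ℂ, ((1 + Complex.I) / 2 * a + (Complex.I - 1) / 2 * b) *
      ((1 + Complex.I) / 2 * a + (Complex.I - 1) / 2 * b) =
      Complex.I / 2 * (a * a - b * b) - a * b := fun a b => by
    linear_combination ((a + b) ^ 2 / 4) * Complex.I_sq
  have h2 : ∀ a b : ℂ, star ((1 + Complex.I) / 2 * a + (Complex.I - 1) / 2 * b) *
      star ((1 + Complex.I) / 2 * a + (Complex.I - 1) / 2 * b) =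
      -Complex.I / 2 * (star a * star a - star b * star b) - star a * star b := fun a b => by
    rw [← star_mul', h1]
    simp
  simp only [quarticMonomial, planeRotation_mulVec_left hpq]
  rw [h1, h2]
  linear_combination (-(x p * x p - x q * x q) / 4 *
    (star (x p) * star (x p) - star (x q) * star (x q))) * Complex.I_sq

theorem quarticMoment_diag_eq (μ : Measure (Matrix.unitaryGroup (Fin d) ℂ))
    [μ.IsMulLeftInvariant] [IsProbabilityMeasure μ] {ψ : Fin d → ℂ}
    (hψ : ∑ i, ‖ψ i‖ ^ 2 = 1) {p q : Fin d} (hpq : p ≠ q) :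
    quarticMoment μ ψ p p p p = 1 / 4 * quarticMoment μ ψ p p p p
      + 1 / 4 * quarticMoment μ ψ q q q q + quarticMoment μ ψ p q p q := by
  have hint := integrable_quarticMonomial μ hψ
  conv_lhs => rw [quarticMoment_eq_integral_mulVec μ ψ (planeRotation_mem_unitaryGroup hpq)]
  simp_rw [quarticMonomial_planeRotation hpq]
  repeat rw [integral_add (by fun_prop) (by fun_prop)]
  simp only [integral_const_mul, integral_quarticMonomial]
  have z : ∀ i j k l : Fin d, ¬(i = k ∧ j = l) → ¬(i = l ∧ j = k) →
    quarticMoment μ ψ i j k l = 0 := fun i j k l => quarticMoment_eq_zero μ ψ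
  rw [z p p q q, z q q p p, z p p p q, z q q p q, z p q p p, z p q q q]
  · ring
  all_goals simp [hpq, hpq.symm]

theorem sum_quarticMoment (μ : Measure (Matrix.unitaryGroup (Fin d) ℂ))
    [IsProbabilityMeasure μ] {ψ : Fin d → ℂ} (hψ : ∑ i, ‖ψ i‖ ^ 2 = 1) :
    ∑ i, ∑ j, quarticMoment μ ψ i j i j = 1 := by
  have hint := integrable_quarticMonomial μ hψ
  have h : ∀ U : Matrix.unitaryGroup (Fin d) ℂ, ∑ i, ∑ j, quarticMonomial i j i j
      ((U : Matrix (Fin d) (Fin d) ℂ).mulVec ψ) = 1 := fun U => by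
    have h1 := sum_mul_star_unitary_mulVec hψ U
    rw [← mul_one (1 : ℂ)]
    nth_rewrite 1 [← h1]
    rw [← h1, Finset.sum_mul_sum]
    refine Finset.sum_congr rfl fun i _ => Finset.sum_congr rfl fun j _ => ?_
    simp only [quarticMonomial]
    ring
  simp only [quarticMoment]
  simp_rw [← integral_finsetSum Finset.univ (fun j _ => hint _ j _ j)]
  rw [← integral_finsetSum]
  · simp [h]
  · exact fun i _ => integrable_finsetSum _ fun j _ => hint i j i j

theorem quarticMoment_eq (μ : Measure (Matrix.unitaryGroup (Fin d) ℂ))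
    [μ.IsMulLeftInvariant] [IsProbabilityMeasure μ] {ψ : Fin d → ℂ}
    (hψ : ∑ i, ‖ψ i‖ ^ 2 = 1) (i j k l : Fin d) :
    quarticMoment μ ψ i j k l = 1 / ((d : ℂ) * ((d : ℂ) + 1)) *
      ((if i = k ∧ j = l then 1 else 0) + (if i = l ∧ j = k then 1 else 0)) := by
  have hsymm : ∀ p q, quarticMoment μ ψ p q p q = quarticMoment μ ψ q p q p := fun p q => by
    simp only [quarticMoment, quarticMonomial]
    congr 1
    ext U
    ring
  have hswap : ∀ p q, quarticMoment μ ψ p q q p = quarticMoment μ ψ p q p q := fun p q => by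
    simp only [quarticMoment, quarticMonomial]
    congr 1
    ext U
    ring
  have hdiag : ∀ p q, quarticMoment μ ψ p p p p = quarticMoment μ ψ q q q q := fun p q => by
    by_cases hpq : p = q
    · rw [hpq]
    · linear_combination quarticMoment_diag_eq μ hψ hpq
        - quarticMoment_diag_eq μ hψ (Ne.symm hpq) + hsymm p q
  have hoff : ∀ p q, p ≠ q → quarticMoment μ ψ p q p q = quarticMoment μ ψ i i i i / 2 :=
    fun p q hpq => by
      linear_combination (-1 : ℂ) * quarticMoment_diag_eq μ hψ hpq + 3 / 4 * hdiag p i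
        - 1 / 4 * hdiag q i
  have hd : (d : ℂ) ≠ 0 := by
    have := i.pos
    exact_mod_cast this.ne'
  have hd1 : (d : ℂ) + 1 ≠ 0 := by exact_mod_cast d.succ_ne_zero
  have hval : quarticMoment μ ψ i i i i = 2 / ((d : ℂ) * ((d : ℂ) + 1)) := by
    have hs := sum_quarticMoment μ hψ
    have hT : ∀ p q, quarticMoment μ ψ p q p q =
        quarticMoment μ ψ i i i i / 2 * (1 + if p = q then 1 else 0) := fun p q => by
      by_cases hpq : p = q
      · subst hpq
        rw [hdiag p i, if_pos rfl]
        ring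
      · rw [hoff p q hpq, if_neg hpq]
        ring
    generalize quarticMoment μ ψ i i i i = a at hT ⊢
    simp_rw [hT, ← Finset.mul_sum, Finset.sum_add_distrib] at hs
    simp at hs
    rw [eq_div_iff (mul_ne_zero hd hd1)]
    linear_combination 2 * hs
  by_cases h₁ : i = k ∧ j = l
  · obtain ⟨rfl, rfl⟩ := h₁
    by_cases hij : i = j
    · subst hij
      rw [hval]
      simp only [and_self, if_true]
      ring
    · have hij : i ≠ j := hij
      rw [hoff i j hij, hval]
      simp only [hij, hij.symm, and_self, if_true, if_false]
      ring
  · by_cases h₂ : i = l ∧ j = k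
    · obtain ⟨rfl, rfl⟩ := h₂
      have hij : i ≠ j := fun h => h₁ ⟨h, h.symm⟩
      rw [hswap, hoff i j hij, hval]
      simp only [hij, hij.symm, and_self, if_true, if_false]
      ring
    · rw [quarticMoment_eq_zero μ ψ h₁ h₂]
      simp [h₁, h₂]

theorem trace_mul_trace_conj_vecMulVec (A B U : Matrix (Fin d) (Fin d) ℂ) (ψ : Fin d → ℂ) :
    (A * (U * Matrix.vecMulVec ψ (star ψ) * star U)).trace
      * (B * (U * Matrix.vecMulVec ψ (star ψ) * star U)).trace
      = ∑ i, ∑ j, ∑ k, ∑ l, A i j * B k l * quarticMonomial j l i k (U.mulVec ψ) := by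
  have h : U * Matrix.vecMulVec ψ (star ψ) * star U =
      Matrix.vecMulVec (U.mulVec ψ) (star (U.mulVec ψ)) := by
    rw [Matrix.mul_vecMulVec, Matrix.vecMulVec_mul, Matrix.star_mulVec,
      Matrix.star_eq_conjTranspose]
  rw [h]
  simp only [Matrix.trace, Matrix.diag_apply, Matrix.mul_apply, Matrix.vecMulVec_apply,
    Pi.star_apply, quarticMonomial]
  simp only [Finset.sum_mul]
  simp only [Finset.mul_sum]
  refine Finset.sum_congr rfl fun i _ => Finset.sum_congr rfl fun j _ =>
    Finset.sum_congr rfl fun k _ => Finset.sum_congr rfl fun l _ => ?_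
  ring

theorem trace_kronecker_mul_symProj (A B : Matrix (Fin d) (Fin d) ℂ) :
    ((A ⊗ₖ B) * symProj d).trace = 1 / 2 * (A.trace * B.trace + ∑ i, ∑ j, A i j * B j i) := by
  have hS : ((A ⊗ₖ B) * swapMatrix d).trace = ∑ i, ∑ j, A i j * B j i := by
    simp only [Matrix.trace, Matrix.diag_apply, Matrix.mul_apply, swapMatrix,
      Matrix.kroneckerMap_apply, Fintype.sum_prod_type, ite_and]
    simp
  rw [symProj, Matrix.mul_smul, Matrix.trace_smul, mul_add, mul_one, Matrix.trace_add,
    Matrix.trace_kronecker, hS, smul_eq_mul]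

end HaarMoments

/-- For the Haar probability measure on `U(d)` and a rank-one projection `ρ = ψψ†`,
`∫ Tr(A UρU†) Tr(B UρU†) dU = (2/(d(d+1))) Tr((A ⊗ B) P_sym)`. -/
theorem haar_average_product_of_traces {d : ℕ} (hd : 0 < d)
    (μ : Measure (Matrix.unitaryGroup (Fin d) ℂ))
    [μ.IsHaarMeasure] [IsProbabilityMeasure μ]
    (ψ : Fin d → ℂ) (hψ : ∑ i, ‖ψ i‖ ^ 2 = 1)
    (A B : Matrix (Fin d) (Fin d) ℂ) :
    ∫ U : Matrix.unitaryGroup (Fin d) ℂ,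
        (A * ((U : Matrix (Fin d) (Fin d) ℂ) * Matrix.vecMulVec ψ (star ψ)
            * star (U : Matrix (Fin d) (Fin d) ℂ))).trace
        * (B * ((U : Matrix (Fin d) (Fin d) ℂ) * Matrix.vecMulVec ψ (star ψ)
            * star (U : Matrix (Fin d) (Fin d) ℂ))).trace ∂μ
      = (2 / ((d : ℂ) * ((d : ℂ) + 1))) * ((A ⊗ₖ B) * symProj d).trace := by
  have hint := integrable_quarticMonomial μ hψ
  have hint1 : ∀ i j k l, Integrable (fun U : Matrix.unitaryGroup (Fin d) ℂ => A i j * B k l *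
      quarticMonomial j l i k ((U : Matrix (Fin d) (Fin d) ℂ).mulVec ψ)) μ :=
    fun i j k l => (hint j l i k).const_mul _
  have hint2 := fun i j k => integrable_finsetSum Finset.univ fun l _ => hint1 i j k l
  have hint3 := fun i j => integrable_finsetSum Finset.univ fun k _ => hint2 i j k
  have hint4 := fun i => integrable_finsetSum Finset.univ fun j _ => hint3 i j
  simp_rw [trace_mul_trace_conj_vecMulVec]
  rw [integral_finsetSum _ fun i _ => hint4 i]
  simp_rw [integral_finsetSum _ fun j _ => hint3 _ j, integral_finsetSum _ fun k _ => hint2 _ _ k,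
    integral_finsetSum _ fun l _ => hint1 _ _ _ l, integral_const_mul,
    integral_quarticMonomial,
    quarticMoment_eq μ hψ]
  rw [trace_kronecker_mul_symProj]
  have h₁ : ∑ i, ∑ j, ∑ k, ∑ l, A i j * B k l * (if j = i ∧ l = k then 1 else 0) =
      A.trace * B.trace := by
    simp [ite_and, Matrix.trace, Finset.sum_mul_sum]
  have h₂ : ∑ i, ∑ j, ∑ k, ∑ l, A i j * B k l * (if j = k ∧ l = i then 1 else 0) =
      ∑ i, ∑ j, A i j * B j i := by
    simp [ite_and]
  rw [← h₁, ← h₂]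
  simp only [← Finset.sum_add_distrib, Finset.mul_sum]
  refine Finset.sum_congr rfl fun i _ => Finset.sum_congr rfl fun j _ =>
    Finset.sum_congr rfl fun k _ => Finset.sum_congr rfl fun l _ => ?_
  ring
end
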